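/- For every ε > 0 there exists C > 0, independent of J and N, such that the following holds for every integer J ≥ 2, every real N ≥ 1, every v ∈ ℓ²(ℤ; ℂ), and every choice of a distinguished leaf among the 2J+1 leaves {a_J} ∪ {b_j, c_j : 1 ≤ j ≤ J} of the first-child chain tree of J generations. For n ∈ ℤ consider all families of frequencies defined recursively by n^{(1)} := n and, for j = 1, …, J, triples (a_j, b_j, c_j) ∈ ℤ³ with a_j − b_j + c_j = n^{(j)}, b_j ∉ {a_j, c_j}, and n^{(j+1)} := a_j; set μ_j := 2(n^{(j)} − a_j)(n^{(j)} − c_j) and μ̃_j := μ₁ + ⋯ + μ_j, and impose |μ₁| > N and, for j = 2, …, J, |μ̃_j| > (2j+1)³ · max(|μ̃_{j−1}|^{1 − 1/100}, |μ₁|^{1 − 1/100}). Writing R(v)_m := |v_m|² v_m − 2(∑_{k ∈ ℤ} |v_k|²) v_m, define Q(n) := ∑ over all such families of (∏_{k=1}^{J} 1/|μ̃_k|) · |R(v)_{ℓ*}| · ∏_{ℓ ≠ ℓ*, ℓ leaf} |v_ℓ|, where ℓ* denotes the frequency at the distinguished leaf. Then Q is finite for every n, belongs to ℓ²(ℤ),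 and ‖Q‖ ≤ C N^{−J/2 + (J−1)/200 + Jε} ‖v‖^{2J+3}. -/

import Mathlib

open scoped BigOperators

/-- The ℓ²(ℤ;ℂ) norm `(∑ₙ |vₙ|²)^{1/2}`. -/
noncomputable def l2norm (v : ℤ → ℂ) : ℝ := Real.sqrt (∑' n : ℤ, ‖v n‖ ^ 2)

/-- Membership in ℓ²(ℤ;ℂ). -/
def Memℓ2 (v : ℤ → ℂ) : Prop := Summable fun n : ℤ => ‖v n‖ ^ 2

/-- The parent frequency `n^{(j)}` of the `j`-th generation of the first-child chain:
`n^{(0)} = n` and `n^{(j)} = a_{j-1}` for `j ≥ 1` (0-indexed generations), where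
`f j = (a_j, b_j, c_j)`. -/
def ngen (n : ℤ) {J : ℕ} (f : Fin J → ℤ × ℤ × ℤ) (j : Fin J) : ℤ :=
  if j.1 = 0 then n
  else (f ⟨j.1 - 1, lt_of_le_of_lt (Nat.sub_le _ _) j.isLt⟩).1

/-- The phase `μ_j = 2(n^{(j)} − a_j)(n^{(j)} − c_j)` introduced at the `j`-th generation. -/
def muGen (n : ℤ) {J : ℕ} (f : Fin J → ℤ × ℤ × ℤ) (j : Fin J) : ℤ :=
  2 * (ngen n f j - (f j).1) * (ngen n f j - (f j).2.2)

/-- The accumulated phase `μ̃_j = μ₀ + ⋯ + μ_j` (0-indexed). -/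
def mutGen (n : ℤ) {J : ℕ} (f : Fin J → ℤ × ℤ × ℤ) (j : Fin J) : ℤ :=
  ∑ k ∈ Finset.Iic j, muGen n f k

/-- The first-child chain conditions of `J` generations with all accumulated phases
non-resonant. -/
def validChain (N : ℝ) (n : ℤ) {J : ℕ} (f : Fin J → ℤ × ℤ × ℤ) : Prop :=
  (∀ j : Fin J, (f j).1 - (f j).2.1 + (f j).2.2 = ngen n f j ∧
    (f j).2.1 ≠ (f j).1 ∧ (f j).2.1 ≠ (f j).2.2) ∧
  (∀ j : Fin J, j.1 = 0 → N < |((muGen n f j : ℤ) : ℝ)|) ∧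
  (∀ j : Fin J, 1 ≤ j.1 →
    ((2 * j.1 + 3 : ℕ) : ℝ) ^ 3 *
      max (|((mutGen n f ⟨j.1 - 1, lt_of_le_of_lt (Nat.sub_le _ _) j.isLt⟩ : ℤ) : ℝ)|
            ^ ((1:ℝ) - 1/100))
          (|((muGen n f ⟨0, j.pos⟩ : ℤ) : ℝ)| ^ ((1:ℝ) - 1/100))
      < |((mutGen n f j : ℤ) : ℝ)|)

/-- The `2J+1` leaves of the first-child chain tree of `J` generations: the last expanded
child `a_J` (`Sum.inl`), and the leaves `b_j` (`Sum.inr (j, true)`) and `c_j`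
(`Sum.inr (j, false)`) for each generation `j`. -/
def Leaf (J : ℕ) := Unit ⊕ Fin J × Bool

instance (J : ℕ) : Fintype (Leaf J) := by unfold Leaf; infer_instance
instance (J : ℕ) : DecidableEq (Leaf J) := by unfold Leaf; infer_instance

/-- The frequency carried by a leaf (junk value for the `a_J`-leaf when `J = 0`). -/
def leafVal (n : ℤ) {J : ℕ} (f : Fin J → ℤ × ℤ × ℤ) : Leaf J → ℤ
  | Sum.inl _ => if h : 0 < J then (f ⟨J - 1, Nat.sub_lt h one_pos⟩).1 else n
  | Sum.inr (j, b) => if b then (f j).2.1 else (f j).2.2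

/-- The resonant part `R(v)ₘ = |vₘ|² vₘ − 2(∑ₖ |vₖ|²) vₘ` of the cubic nonlinearity. -/
noncomputable def Rres (v : ℤ → ℂ) (m : ℤ) : ℂ :=
  (‖v m‖ : ℂ) ^ 2 * v m - 2 * ((∑' k : ℤ, ‖v k‖ ^ 2 : ℝ) : ℂ) * v m

/-- The summand `(∏_k 1/|μ̃_k|) |R(v)_{ℓ*}| ∏_{ℓ ≠ ℓ*} |v_ℓ|` of the resonant-derivative
term `N^{(J+1)}_r`, with distinguished leaf `ℓ*`. -/
noncomputable def term14 (v : ℤ → ℂ) (n : ℤ) {J : ℕ} (lstar : Leaf J)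
    (f : Fin J → ℤ × ℤ × ℤ) : ℝ :=
  (∏ k : Fin J, 1 / |((mutGen n f k : ℤ) : ℝ)|) * ‖Rres v (leafVal n f lstar)‖ *
    ∏ l ∈ Finset.univ.erase lstar, ‖v (leafVal n f l)‖

/-- The majorant `Q(n)` of the resonant-derivative term `N^{(J+1)}_r` (first-child chain
tree, distinguished leaf `ℓ*`). -/
noncomputable def Q14 (N : ℝ) (v : ℤ → ℂ) (J : ℕ) (lstar : Leaf J) (n : ℤ) : ℝ :=
  ∑' f : {f : Fin J → ℤ × ℤ × ℤ // validChain N n f}, term14 v n lstar f.1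

theorem card_divisors_le_const_mul_rpow {δ : ℝ} (hδ : 0 < δ) :
    ∃ C : ℝ, 0 < C ∧ ∀ n : ℕ, n ≠ 0 → (n.divisors.card : ℝ) ≤ C * (n : ℝ) ^ δ := by
  have hl : 0 < Real.log 2 := Real.log_pos one_lt_two
  set c : ℝ := 1 + 1 / (δ * Real.log 2) with hc
  have hc1 : 1 ≤ c := by
    have : 0 ≤ 1 / (δ * Real.log 2) := by positivity
    linarith
  set P : ℕ := ⌈(2 : ℝ) ^ (1 / δ)⌉₊ with hP
  refine ⟨c ^ P, by positivity, fun n hn => ?_⟩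
  have hfac : ∀ p ∈ n.primeFactors, ((n.factorization p + 1 : ℕ) : ℝ) ≤
      (if p < P then c else 1) * ((p : ℝ) ^ δ) ^ n.factorization p := by
    intro p hp
    have hp2 : (2 : ℝ) ≤ p := by exact_mod_cast (Nat.prime_of_mem_primeFactors hp).two_le
    generalize n.factorization p = a
    split_ifs with h
    · have h1 : (2 : ℝ) ^ δ ≤ (p : ℝ) ^ δ := Real.rpow_le_rpow (by norm_num) hp2 hδ.le
      have h2 : 1 + δ * Real.log 2 * a ≤ ((2 : ℝ) ^ δ) ^ a := by
        rw [← Real.rpow_mul_natCast (by norm_num), Real.rpow_def_of_pos (by norm_num)]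
        have := Real.add_one_le_exp (Real.log 2 * (δ * a))
        linarith
      calc ((a + 1 : ℕ) : ℝ) ≤ c * (1 + δ * Real.log 2 * a) := by
            have : c * (1 + δ * Real.log 2 * a) = c + (δ * Real.log 2 + 1) * a := by
              rw [hc]; field_simp
            rw [this]; push_cast
            have : 0 ≤ δ * Real.log 2 * a := by positivity
            linarith
        _ ≤ c * ((p : ℝ) ^ δ) ^ a := by
            gcongr
            exact h2.trans (pow_le_pow_left₀ (by positivity) h1 a)
    · have h1 : (2 : ℝ) ^ (1 / δ) ≤ p := (Nat.le_ceil _).trans (by exact_mod_cast not_lt.1 h)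
      have h2 : (2 : ℝ) ≤ (p : ℝ) ^ δ := by
        have := Real.rpow_le_rpow (by positivity) h1 hδ.le
        rwa [← Real.rpow_mul (by norm_num), one_div_mul_cancel hδ.ne', Real.rpow_one] at this
      rw [one_mul]
      calc ((a + 1 : ℕ) : ℝ) ≤ (2 : ℝ) ^ a := by exact_mod_cast Nat.lt_two_pow_self
        _ ≤ _ := pow_le_pow_left₀ (by norm_num) h2 a
  have hprod : ∏ p ∈ n.primeFactors, ((p : ℝ) ^ δ) ^ n.factorization p = (n : ℝ) ^ δ := by
    have h := Nat.prod_factorization_pow_eq_self hn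
    conv_rhs => rw [← h]
    rw [Finsupp.prod, Nat.support_factorization, Nat.cast_prod,
      ← Real.finsetProd_rpow _ _ (fun _ _ => by positivity)]
    refine Finset.prod_congr rfl fun p _ => ?_
    rw [Nat.cast_pow, ← Real.rpow_natCast_mul (by positivity), ← Real.rpow_mul_natCast
      (by positivity), mul_comm]
  rw [Nat.card_divisors hn, Nat.cast_prod]
  calc _ ≤ ∏ p ∈ n.primeFactors,
        (if p < P then c else 1) * ((p : ℝ) ^ δ) ^ n.factorization p :=
        Finset.prod_le_prod (fun _ _ => by positivity) hfac
    _ = c ^ (n.primeFactors.filter (· < P)).card * (n : ℝ) ^ δ := by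
        rw [Finset.prod_mul_distrib, hprod, Finset.prod_ite, Finset.prod_const,
          Finset.prod_const_one, mul_one]
    _ ≤ c ^ P * (n : ℝ) ^ δ := by
        gcongr
        calc _ ≤ (Finset.range P).card := Finset.card_le_card fun p hp => by
              simpa using (Finset.mem_filter.1 hp).2
          _ = P := Finset.card_range P

theorem ENNReal.tsum_mul_sq_le {ι : Type*} (f g : ι → ENNReal) :
    (∑' i, f i * g i) ^ 2 ≤ (∑' i, f i ^ 2) * ∑' i, g i ^ 2 := by
  let _ : MeasurableSpace ι := ⊤
  have h := ENNReal.lintegral_mul_le_Lp_mul_Lq (MeasureTheory.Measure.count (α := ι))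
    Real.HolderConjugate.two_two (f := f) (g := g) measurable_from_top.aemeasurable
    measurable_from_top.aemeasurable
  simp only [MeasureTheory.lintegral_count, Pi.mul_apply, ENNReal.rpow_two] at h
  calc _ ≤ _ := pow_le_pow_left' h 2
    _ = _ := by
      rw [mul_pow, ← ENNReal.rpow_two, ← ENNReal.rpow_two, ← ENNReal.rpow_mul,
        ← ENNReal.rpow_mul]
      norm_num

theorem ENNReal.tsum_prod_apply_le {ι α : Type*} [Fintype ι] [DecidableEq ι]
    (h : α → ENNReal) :
    ∑' g : ι → α, ∏ i, h (g i) ≤ (∑' a, h a) ^ Fintype.card ι := by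
  classical
  rw [ENNReal.tsum_eq_iSup_sum]
  refine iSup_le fun s => ?_
  let T : Finset α := s.biUnion fun g => Finset.univ.image g
  calc ∑ g ∈ s, ∏ i, h (g i) ≤ ∑ g ∈ Fintype.piFinset fun _ : ι => T, ∏ i, h (g i) := by
        refine Finset.sum_le_sum_of_subset fun g hg => ?_
        rw [Fintype.mem_piFinset]
        exact fun i => Finset.mem_biUnion.2 ⟨g, hg, Finset.mem_image_of_mem _ (Finset.mem_univ i)⟩
    _ = (∑ a ∈ T, h a) ^ Fintype.card ι := by
        rw [← Finset.prod_univ_sum, Finset.prod_const, Finset.card_univ]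
    _ ≤ _ := pow_le_pow_left' (ENNReal.sum_le_tsum _) _

theorem summable_and_tsum_le_of_tsum_ofReal_le {ι : Type*} {g : ι → ℝ} {c : ℝ}
    (hg : ∀ i, 0 ≤ g i) (hc : 0 ≤ c) (h : ∑' i, ENNReal.ofReal (g i) ≤ ENNReal.ofReal c) :
    Summable g ∧ ∑' i, g i ≤ c := by
  have hs : Summable g := by
    have := ENNReal.summable_toReal (h.trans_lt ENNReal.ofReal_lt_top).ne
    simpa only [ENNReal.toReal_ofReal (hg _)] using this
  refine ⟨hs, ?_⟩
  rwa [← ENNReal.ofReal_tsum_of_nonneg hg hs, ENNReal.ofReal_le_ofReal_iff hc] at h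

theorem Int.card_divisor_finset_le (q : ℤ) :
    ∃ D : Finset ℤ, (∀ d : ℤ, q ≠ 0 → d ∣ q → d ∈ D) ∧ D.card ≤ 2 * q.natAbs.divisors.card := by
  refine ⟨q.natAbs.divisors.image (fun d : ℕ => (d : ℤ)) ∪
    q.natAbs.divisors.image (fun d : ℕ => -(d : ℤ)), fun d hq hd => ?_, ?_⟩
  · have hm : d.natAbs ∈ q.natAbs.divisors :=
      Nat.mem_divisors.2 ⟨Int.natAbs_dvd_natAbs.2 hd, Int.natAbs_ne_zero.2 hq⟩
    rw [Finset.mem_union, Finset.mem_image, Finset.mem_image]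
    rcases Int.natAbs_eq d with h | h
    · exact Or.inl ⟨_, hm, h.symm⟩
    · exact Or.inr ⟨_, hm, h.symm⟩
  · refine (Finset.card_union_le _ _).trans ?_
    have h1 := Finset.card_image_le (s := q.natAbs.divisors) (f := fun d : ℕ => (d : ℤ))
    have h2 := Finset.card_image_le (s := q.natAbs.divisors) (f := fun d : ℕ => -(d : ℤ))
    omega

/-- One generation of the chain: children `x = (a, b, c)` of the parent frequency `p`, with
the accumulated phase moving from `t` to `t + 2 (p - a) (p - c)`. -/
def stepValid (p t : ℤ) (x : ℤ × ℤ × ℤ) : Prop :=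
  (x.1 - x.2.1 + x.2.2 = p ∧ x.2.1 ≠ x.1 ∧ x.2.1 ≠ x.2.2) ∧
    t + 2 * (p - x.1) * (p - x.2.2) ≠ 0 ∧
    |2 * (p - x.1) * (p - x.2.2)| ≤ 2 * (t + 2 * (p - x.1) * (p - x.2.2)) ^ 2

open Classical in
theorem exists_tsum_stepValid_le {s : ℝ} (hs : 0 < s) :
    ∃ K : ℝ, 0 ≤ K ∧ ∀ p t : ℤ,
      (∑' x : ℤ × ℤ × ℤ, if stepValid p t x then
        ENNReal.ofReal (|((t + 2 * (p - x.1) * (p - x.2.2) : ℤ) : ℝ)| ^ (-(1 + s))) else 0)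
      ≤ ENNReal.ofReal K := by
  obtain ⟨C, hC, hdiv⟩ := card_divisors_le_const_mul_rpow (δ := s / 4) (by positivity)
  have hsum : Summable fun m : ℤ => |(m : ℝ)| ^ (-(1 + s / 2)) :=
    Real.summable_abs_int_rpow (by linarith)
  set c : ℝ := 2 * C * 2 ^ (s / 4)
  refine ⟨∑' m : ℤ, c * |(m : ℝ)| ^ (-(1 + s / 2)),
    tsum_nonneg fun m => by positivity, fun p t => ?_⟩
  let F : ℤ × ℤ → ENNReal := fun y =>
    if y.1 ≠ 0 ∧ y.1 - t ≠ 0 ∧ |y.1 - t| ≤ 2 * y.1 ^ 2 ∧ y.2 ∣ y.1 - t then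
      ENNReal.ofReal (|(y.1 : ℝ)| ^ (-(1 + s))) else 0
  let i : {x | stepValid p t x} → ℤ × ℤ := fun x =>
    (t + 2 * (p - x.1.1) * (p - x.1.2.2), p - x.1.1)
  have hne : ∀ x, stepValid p t x → p - x.1 ≠ 0 ∧ p - x.2.2 ≠ 0 := by
    rintro ⟨a, b, c⟩ ⟨⟨h1, h2, h3⟩, -⟩
    dsimp only at *
    constructor <;> omega
  have hi : Function.Injective i := by
    rintro ⟨⟨a, b, c⟩, hx⟩ ⟨⟨a', b', c'⟩, hx'⟩ h
    have hx0 := (hne _ hx).1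
    have h1 := hx.1.1
    have h1' := hx'.1.1
    simp only [i, Prod.mk.injEq] at h
    dsimp only at h1 h1' hx0
    obtain ⟨h2, h3⟩ := h
    rw [← h3] at h2
    have h4 : p - c = p - c' := by
      apply mul_left_cancel₀ (mul_ne_zero two_ne_zero hx0)
      linarith
    simp only [Subtype.mk.injEq, Prod.mk.injEq]
    omega
  calc _ = ∑' x : {x | stepValid p t x}, F (i x) := by
        rw [tsum_subtype {x | stepValid p t x} (fun x : ℤ × ℤ × ℤ =>
          F (t + 2 * (p - x.1) * (p - x.2.2), p - x.1))]
        refine tsum_congr fun x => ?_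
        by_cases hx : stepValid p t x
        · rw [if_pos hx, Set.indicator_of_mem (by exact hx)]
          have h0 := hne x hx
          have : (t + 2 * (p - x.1) * (p - x.2.2)) - t = 2 * (p - x.1) * (p - x.2.2) := by ring
          simp only [F]
          rw [if_pos]
          rw [this]
          exact ⟨hx.2.1, mul_ne_zero (mul_ne_zero two_ne_zero h0.1) h0.2, hx.2.2,
            Dvd.intro_left 2 rfl |>.mul_right _⟩
        · rw [if_neg hx, Set.indicator_of_notMem (by exact hx)]
    _ ≤ ∑' y, F y := ENNReal.tsum_comp_le_tsum_of_injective hi F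
    _ = ∑' m : ℤ, ∑' d : ℤ, F (m, d) :=
        ENNReal.tsum_prod (f := fun m d => F (m, d))
    _ ≤ ∑' m : ℤ, ENNReal.ofReal (c * |(m : ℝ)| ^ (-(1 + s / 2))) := by
        refine ENNReal.tsum_le_tsum fun m => ?_
        by_cases hm : m ≠ 0 ∧ m - t ≠ 0 ∧ |m - t| ≤ 2 * m ^ 2
        · obtain ⟨D, hD, hcard⟩ := Int.card_divisor_finset_le (m - t)
          have hm0 : 0 < |(m : ℝ)| := abs_pos.2 (by exact_mod_cast hm.1)
          calc ∑' d : ℤ, F (m, d) = ∑ d ∈ D, F (m, d) := by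
                refine tsum_eq_sum fun d hd => ?_
                exact if_neg fun h => hd (hD d h.2.1 h.2.2.2)
            _ ≤ ∑ d ∈ D, ENNReal.ofReal (|(m : ℝ)| ^ (-(1 + s))) := by
                refine Finset.sum_le_sum fun d _ => ?_
                simp only [F]
                split_ifs <;> simp
            _ = ENNReal.ofReal (D.card * |(m : ℝ)| ^ (-(1 + s))) := by
                rw [Finset.sum_const, nsmul_eq_mul, ENNReal.ofReal_mul (by positivity),
                  ENNReal.ofReal_natCast]
            _ ≤ _ := by
                refine ENNReal.ofReal_le_ofReal ?_
                have h1 : (D.card : ℝ) ≤ 2 * ((m - t).natAbs.divisors.card : ℝ) := by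
                  exact_mod_cast hcard
                have h2 := hdiv (m - t).natAbs (Int.natAbs_ne_zero.2 hm.2.1)
                have h3 : ((m - t).natAbs : ℝ) ≤ 2 * |(m : ℝ)| ^ (2 : ℝ) := by
                  rw [Nat.cast_natAbs, Real.rpow_two, sq_abs]
                  exact_mod_cast hm.2.2
                have h4 : ((m - t).natAbs : ℝ) ^ (s / 4) ≤
                    2 ^ (s / 4) * |(m : ℝ)| ^ (s / 2) := by
                  refine (Real.rpow_le_rpow (by positivity) h3 (by positivity)).trans_eq ?_
                  rw [Real.mul_rpow (by norm_num) (by positivity), ← Real.rpow_mul hm0.le]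
                  congr 2; ring
                have h5 : |(m : ℝ)| ^ (-(1 + s / 2)) =
                    |(m : ℝ)| ^ (s / 2) * |(m : ℝ)| ^ (-(1 + s)) := by
                  rw [← Real.rpow_add hm0]; congr 1; ring
                rw [h5, ← mul_assoc]
                gcongr
                calc (D.card : ℝ) ≤ 2 * (C * (2 ^ (s / 4) * |(m : ℝ)| ^ (s / 2))) := by
                      refine h1.trans ?_
                      gcongr
                      exact h2.trans (by gcongr)
                  _ = _ := by simp only [c]; ring
        · refine le_trans (le_of_eq ?_) zero_le
          refine ENNReal.tsum_eq_zero.2 fun d => if_neg fun h => hm ⟨h.1, h.2.1, h.2.2.1⟩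
    _ = _ := (ENNReal.ofReal_tsum_of_nonneg (fun m => by positivity) (hsum.mul_left c)).symm

section Snoc

variable (n : ℤ) {J : ℕ} (g : Fin J → ℤ × ℤ × ℤ) (x : ℤ × ℤ × ℤ)

/-- The last expanded child `a_J`, which is the root `n` for the empty chain. -/
def chainEnd : ℤ := if h : 0 < J then (g ⟨J - 1, Nat.sub_lt h one_pos⟩).1 else n

theorem ngen_snoc_castSucc (k : Fin J) :
    ngen n (Fin.snoc (α := fun _ => ℤ × ℤ × ℤ) g x) k.castSucc = ngen n g k := by
  unfold ngen
  split_ifs with h1 h2 h2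
  · rfl
  · exact absurd h1 h2
  · exact absurd h2 h1
  · have : (⟨k.castSucc.1 - 1, lt_of_le_of_lt (Nat.sub_le _ _) k.castSucc.isLt⟩ : Fin (J + 1)) =
        Fin.castSucc ⟨k.1 - 1, lt_of_le_of_lt (Nat.sub_le _ _) k.isLt⟩ := rfl
    rw [this, Fin.snoc_castSucc]

theorem ngen_snoc_last :
    ngen n (Fin.snoc (α := fun _ => ℤ × ℤ × ℤ) g x) (Fin.last J) = chainEnd n g := by
  unfold ngen chainEnd
  by_cases h : 0 < J
  · rw [dif_pos h, if_neg (by simpa using h.ne')]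
    have : (⟨(Fin.last J).1 - 1, lt_of_le_of_lt (Nat.sub_le _ _) (Fin.last J).isLt⟩ :
        Fin (J + 1)) = Fin.castSucc ⟨J - 1, Nat.sub_lt h one_pos⟩ := rfl
    rw [this, Fin.snoc_castSucc]
  · rw [dif_neg h, if_pos (by simpa using h)]

theorem muGen_snoc_castSucc (k : Fin J) :
    muGen n (Fin.snoc (α := fun _ => ℤ × ℤ × ℤ) g x) k.castSucc = muGen n g k := by
  unfold muGen
  rw [ngen_snoc_castSucc, Fin.snoc_castSucc]

theorem muGen_snoc_last :
    muGen n (Fin.snoc (α := fun _ => ℤ × ℤ × ℤ) g x) (Fin.last J) =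
      2 * (chainEnd n g - x.1) * (chainEnd n g - x.2.2) := by
  unfold muGen
  rw [ngen_snoc_last, Fin.snoc_last]

theorem mutGen_snoc_castSucc (k : Fin J) :
    mutGen n (Fin.snoc (α := fun _ => ℤ × ℤ × ℤ) g x) k.castSucc = mutGen n g k := by
  unfold mutGen
  rw [← Fin.map_castSuccEmb_Iic, Finset.sum_map]
  exact Finset.sum_congr rfl fun i _ => muGen_snoc_castSucc n g x i

theorem mutGen_snoc_last :
    mutGen n (Fin.snoc (α := fun _ => ℤ × ℤ × ℤ) g x) (Fin.last J) =
      (∑ k, muGen n g k) + 2 * (chainEnd n g - x.1) * (chainEnd n g - x.2.2) := by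
  unfold mutGen
  have : Finset.Iic (Fin.last J) = Finset.univ := by
    ext i; simp [Fin.le_last]
  rw [this, Fin.sum_univ_castSucc, muGen_snoc_last]
  simp only [muGen_snoc_castSucc]

end Snoc

theorem tsum_prod_chain_le {K : ENNReal} (W : ℤ → ℤ → ℤ × ℤ × ℤ → ENNReal)
    (hW : ∀ p t, ∑' x, W p t x ≤ K) (n : ℤ) (J : ℕ) :
    ∑' f : Fin J → ℤ × ℤ × ℤ,
      ∏ k, W (ngen n f k) (mutGen n f k - muGen n f k) (f k) ≤ K ^ J := by
  induction J with
  | zero => simp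
  | succ J ih =>
    rw [← (Fin.snocEquiv fun _ : Fin (J + 1) => ℤ × ℤ × ℤ).tsum_eq]
    simp only [Fin.snocEquiv, Equiv.coe_fn_mk]
    rw [ENNReal.tsum_prod (f := fun x g => ∏ k : Fin (J + 1),
      W (ngen n (Fin.snoc (α := fun _ => ℤ × ℤ × ℤ) g x) k)
        (mutGen n (Fin.snoc (α := fun _ => ℤ × ℤ × ℤ) g x) k -
          muGen n (Fin.snoc (α := fun _ => ℤ × ℤ × ℤ) g x) k)
        (Fin.snoc (α := fun _ => ℤ × ℤ × ℤ) g x k)), ENNReal.tsum_comm]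
    simp only [Fin.prod_univ_castSucc, ngen_snoc_castSucc, mutGen_snoc_castSucc,
      muGen_snoc_castSucc, Fin.snoc_castSucc, ngen_snoc_last, mutGen_snoc_last,
      muGen_snoc_last, Fin.snoc_last, add_sub_cancel_right, ENNReal.tsum_mul_left]
    rw [pow_succ]
    calc _ ≤ ∑' g : Fin J → ℤ × ℤ × ℤ,
          (∏ k, W (ngen n g k) (mutGen n g k - muGen n g k) (g k)) * K :=
          ENNReal.tsum_le_tsum fun g => mul_le_mul_right (hW _ _) _
      _ ≤ _ := by
          rw [ENNReal.tsum_mul_right]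
          exact mul_le_mul_left ih _

theorem leafVal_injective {N : ℝ} {J : ℕ} (hJ : 0 < J) :
    Function.Injective fun y : (Σ n : ℤ, {f : Fin J → ℤ × ℤ × ℤ // validChain N n f}) =>
      (leafVal y.1 y.2.1 : Leaf J → ℤ) := by
  rintro ⟨n, f, hf⟩ ⟨n', f', hf'⟩ h
  dsimp only at h
  have hb : ∀ j, (f j).2.1 = (f' j).2.1 := fun j => congrFun h (Sum.inr (j, true))
  have hc : ∀ j, (f j).2.2 = (f' j).2.2 := fun j => congrFun h (Sum.inr (j, false))
  have hlast : (f ⟨J - 1, Nat.sub_lt hJ one_pos⟩).1 = (f' ⟨J - 1, Nat.sub_lt hJ one_pos⟩).1 := by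
    simpa [leafVal, hJ] using congrFun h (Sum.inl ())
  have hg : ∀ j, (f j).1 = (f' j).1 → ngen n f j = ngen n' f' j := fun j hj => by
    rw [← (hf.1 j).1, ← (hf'.1 j).1, hj, hb, hc]
  have ha : ∀ i : ℕ, ∀ hi : i < J, (f ⟨J - 1 - i, by omega⟩).1 = (f' ⟨J - 1 - i, by omega⟩).1 := by
    intro i
    induction i with
    | zero => exact fun _ => hlast
    | succ i ih =>
      intro hi
      have := hg _ (ih (by omega))
      unfold ngen at this
      rwa [if_neg (by dsimp only; omega), if_neg (by dsimp only; omega)] at this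
  have ha' : ∀ j, (f j).1 = (f' j).1 := fun j => by
    have := ha (J - 1 - j.1) (by omega)
    have hj : J - 1 - (J - 1 - j.1) = j.1 := by omega
    simpa only [hj] using this
  obtain rfl : f = f' := funext fun j => Prod.ext (ha' j) (Prod.ext (hb j) (hc j))
  obtain rfl : n = n' := by simpa [ngen] using hg ⟨0, hJ⟩ rfl
  rfl

theorem one_div_sq_le_of_lower_bound {N s θ x : ℝ} {k : ℕ} (hN : 1 ≤ N) (hs : s ≤ 1 / 2)
    (hx : ((k : ℝ) + 1) ^ 2 * N ^ θ ≤ x) :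
    (1 / x) ^ 2 ≤ N ^ (-(θ * (1 - s))) / ((k : ℝ) + 1) * x ^ (-(1 + s)) := by
  have hN0 : 0 < N := by linarith
  have hk : (1 : ℝ) ≤ (k : ℝ) + 1 := by
    have : (0 : ℝ) ≤ k := k.cast_nonneg
    linarith
  have hx0 : 0 < x := lt_of_lt_of_le (by positivity) hx
  have h1 : ((k : ℝ) + 1) * N ^ (θ * (1 - s)) ≤ x ^ (1 - s) := by
    calc ((k : ℝ) + 1) * N ^ (θ * (1 - s))
        ≤ ((k : ℝ) + 1) ^ (2 * (1 - s)) * N ^ (θ * (1 - s)) := by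
          gcongr
          exact Real.self_le_rpow_of_one_le hk (by linarith)
      _ = (((k : ℝ) + 1) ^ 2 * N ^ θ) ^ (1 - s) := by
          rw [Real.mul_rpow (by positivity) (by positivity), ← Real.rpow_mul hN0.le,
            Real.rpow_mul (by positivity), Real.rpow_two]
      _ ≤ _ := Real.rpow_le_rpow (by positivity) hx (by linarith)
  have h2 : (1 / x) ^ 2 = x ^ (-(1 + s)) / x ^ (1 - s) := by
    rw [← Real.rpow_sub hx0, one_div, inv_pow, ← Real.rpow_two, ← Real.rpow_neg hx0.le]
    congr 1; ring
  calc (1 / x) ^ 2 = x ^ (-(1 + s)) / x ^ (1 - s) := h2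
    _ ≤ x ^ (-(1 + s)) / (((k : ℝ) + 1) * N ^ (θ * (1 - s))) := by gcongr
    _ = _ := by rw [Real.rpow_neg hN0.le]; field_simp

theorem mutGen_of_val_eq_zero (n : ℤ) {J : ℕ} (f : Fin J → ℤ × ℤ × ℤ) {k : Fin J}
    (hk : k.1 = 0) : mutGen n f k = muGen n f k := by
  unfold mutGen
  have : Finset.Iic k = {k} := by
    ext i; simp only [Finset.mem_Iic, Finset.mem_singleton, Fin.le_def, Fin.ext_iff]; omega
  rw [this, Finset.sum_singleton]

theorem mutGen_eq_add (n : ℤ) {J : ℕ} (f : Fin J → ℤ × ℤ × ℤ) {k : Fin J} (hk : 1 ≤ k.1) :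
    mutGen n f k =
      mutGen n f ⟨k.1 - 1, lt_of_le_of_lt (Nat.sub_le _ _) k.isLt⟩ + muGen n f k := by
  unfold mutGen
  have : Finset.Iic k =
      insert k (Finset.Iic ⟨k.1 - 1, lt_of_le_of_lt (Nat.sub_le _ _) k.isLt⟩) := by
    ext i; simp only [Finset.mem_Iic, Finset.mem_insert, Fin.le_def, Fin.ext_iff]; omega
  rw [this, Finset.sum_insert, add_comm]
  simp only [Finset.mem_Iic, Fin.le_def]
  omega

/-- The exponent of `N` in the lower bound for the `k`-th accumulated phase. -/
noncomputable def phaseExponent (k : ℕ) : ℝ := if k = 0 then 1 else 1 - 1 / 100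

theorem validChain.le_abs_mutGen {N : ℝ} (hN : 1 ≤ N) {n : ℤ} {J : ℕ}
    {f : Fin J → ℤ × ℤ × ℤ} (hf : validChain N n f) (k : Fin J) :
    ((k.1 : ℝ) + 1) ^ 2 * N ^ phaseExponent k.1 ≤ |((mutGen n f k : ℤ) : ℝ)| := by
  unfold phaseExponent
  by_cases hk : k.1 = 0
  · rw [mutGen_of_val_eq_zero n f hk, if_pos hk, hk, Real.rpow_one]
    simpa using (hf.2.1 k hk).le
  · rw [if_neg hk]
    refine le_trans ?_ (hf.2.2 k (by omega)).le
    have h0 := (hf.2.1 ⟨0, k.pos⟩ rfl).le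
    have hk0 : (0 : ℝ) ≤ k.1 := k.1.cast_nonneg
    have h1 : N ^ ((1 : ℝ) - 1 / 100) ≤ max
        (|((mutGen n f ⟨k.1 - 1, lt_of_le_of_lt (Nat.sub_le _ _) k.isLt⟩ : ℤ) : ℝ)|
            ^ ((1:ℝ) - 1/100))
        (|((muGen n f ⟨0, k.pos⟩ : ℤ) : ℝ)| ^ ((1:ℝ) - 1/100)) :=
      le_max_of_le_right (Real.rpow_le_rpow (by linarith) h0 (by norm_num))
    refine mul_le_mul ?_ h1 (by positivity) (by positivity)
    push_cast
    calc ((k.1 : ℝ) + 1) ^ 2 ≤ (2 * (k.1 : ℝ) + 3) ^ 2 := by gcongr <;> linarith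
      _ ≤ (2 * (k.1 : ℝ) + 3) ^ 3 := pow_le_pow_right₀ (by linarith) (by norm_num)

theorem validChain.one_le_abs_mutGen {N : ℝ} (hN : 1 ≤ N) {n : ℤ} {J : ℕ}
    {f : Fin J → ℤ × ℤ × ℤ} (hf : validChain N n f) (k : Fin J) :
    1 ≤ |((mutGen n f k : ℤ) : ℝ)| := by
  refine le_trans ?_ (hf.le_abs_mutGen hN k)
  have hθ : 0 ≤ phaseExponent k.1 := by
    unfold phaseExponent; split_ifs <;> norm_num
  have hk0 : (0 : ℝ) ≤ k.1 := k.1.cast_nonneg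
  exact one_le_mul_of_one_le_of_one_le (one_le_pow₀ (by linarith)) (Real.one_le_rpow hN hθ)

theorem validChain.stepValid {N : ℝ} (hN : 1 ≤ N) {n : ℤ} {J : ℕ}
    {f : Fin J → ℤ × ℤ × ℤ} (hf : validChain N n f) (k : Fin J) :
    stepValid (ngen n f k) (mutGen n f k - muGen n f k) (f k) := by
  have h1 := hf.one_le_abs_mutGen hN k
  have hM : mutGen n f k - muGen n f k +
      2 * (ngen n f k - (f k).1) * (ngen n f k - (f k).2.2) = mutGen n f k :=
    sub_add_cancel _ _
  refine ⟨hf.1 k, ?_, ?_⟩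
  · rw [hM]
    rintro h
    rw [h] at h1
    norm_num at h1
  rw [hM]
  change |muGen n f k| ≤ _
  set M : ℝ := |((mutGen n f k : ℤ) : ℝ)| with hMdef
  suffices h : |((muGen n f k : ℤ) : ℝ)| ≤ 2 * M ^ 2 by
    rw [hMdef, sq_abs] at h
    exact_mod_cast h
  by_cases hk : k.1 = 0
  · rw [← mutGen_of_val_eq_zero n f hk]
    nlinarith
  · set P : ℝ :=
      |((mutGen n f ⟨k.1 - 1, lt_of_le_of_lt (Nat.sub_le _ _) k.isLt⟩ : ℤ) : ℝ)| with hP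
    have hP0 : 0 ≤ P := abs_nonneg _
    have h2 : P ^ ((1 : ℝ) - 1 / 100) ≤ M := by
      refine le_trans (le_trans (le_max_left _
        (|((muGen n f ⟨0, k.pos⟩ : ℤ) : ℝ)| ^ ((1:ℝ) - 1/100))) ?_) (hf.2.2 k (by omega)).le
      refine le_mul_of_one_le_left (le_max_of_le_left (by positivity)) ?_
      exact one_le_pow₀ (by exact_mod_cast (by omega : 1 ≤ 2 * k.1 + 3))
    have h3 : P ≤ M ^ 2 := by
      by_contra! h
      have h4 : (M ^ 2) ^ ((1 : ℝ) - 1 / 100) < P ^ ((1 : ℝ) - 1 / 100) :=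
        Real.rpow_lt_rpow (by positivity) h (by norm_num)
      have h5 : M ≤ (M ^ 2) ^ ((1 : ℝ) - 1 / 100) := by
        rw [← Real.rpow_two, ← Real.rpow_mul (by linarith)]
        exact Real.self_le_rpow_of_one_le h1 (by norm_num)
      linarith
    have h4 : ((muGen n f k : ℤ) : ℝ) = ((mutGen n f k : ℤ) : ℝ) -
        ((mutGen n f ⟨k.1 - 1, lt_of_le_of_lt (Nat.sub_le _ _) k.isLt⟩ : ℤ) : ℝ) := by
      rw [mutGen_eq_add n f (by omega : 1 ≤ k.1)]
      push_cast; ring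
    rw [h4]
    refine (abs_sub _ _).trans ?_
    nlinarith

theorem prod_phaseExponent_eq {N : ℝ} (hN : 0 < N) (s : ℝ) {J : ℕ} (hJ : 0 < J) :
    ∏ k : Fin J, N ^ (-(phaseExponent k.1 * (1 - s))) / ((k.1 : ℝ) + 1) =
      N ^ (-((1 - s) * (1 + (1 - 1 / 100) * ((J : ℝ) - 1)))) / (J.factorial : ℝ) := by
  rw [Finset.prod_div_distrib]
  congr 1
  · obtain ⟨m, rfl⟩ : ∃ m, J = m + 1 := ⟨J - 1, by omega⟩
    rw [Fin.prod_univ_succ]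
    simp only [phaseExponent, Fin.val_zero, Fin.val_succ, if_true, Nat.add_eq_zero_iff,
      one_ne_zero, and_false, if_false, Finset.prod_const, Finset.card_univ, Fintype.card_fin]
    rw [← Real.rpow_mul_natCast hN.le, ← Real.rpow_add hN]
    congr 1
    push_cast; ring
  · rw [Fin.prod_univ_eq_prod_range (fun k : ℕ => (k : ℝ) + 1) J,
      ← Finset.prod_range_add_one_eq_factorial]
    push_cast; rfl

theorem exists_tsum_validChain_le {s : ℝ} (hs : 0 < s) (hs' : s ≤ 1 / 2) :
    ∃ K : ℝ, 0 ≤ K ∧ ∀ (J : ℕ) (N : ℝ) (n : ℤ), 0 < J → 1 ≤ N →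
      ∑' f : {f : Fin J → ℤ × ℤ × ℤ // validChain N n f},
        ENNReal.ofReal ((∏ k : Fin J, 1 / |((mutGen n f.1 k : ℤ) : ℝ)|) ^ 2) ≤
      ENNReal.ofReal
        (N ^ (-((1 - s) * (1 + (1 - 1 / 100) * ((J : ℝ) - 1)))) * Real.exp K) := by
  classical
  obtain ⟨K, hK, hstep⟩ := exists_tsum_stepValid_le hs
  refine ⟨K, hK, fun J N n hJ hN => ?_⟩
  have hN0 : 0 < N := by linarith
  let W : ℤ → ℤ → ℤ × ℤ × ℤ → ENNReal := fun p t x => if stepValid p t x then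
    ENNReal.ofReal (|((t + 2 * (p - x.1) * (p - x.2.2) : ℤ) : ℝ)| ^ (-(1 + s))) else 0
  let Φ : (Fin J → ℤ × ℤ × ℤ) → ENNReal := fun f =>
    ∏ k, W (ngen n f k) (mutGen n f k - muGen n f k) (f k)
  set c : ℝ := ∏ k : Fin J, N ^ (-(phaseExponent k.1 * (1 - s))) / ((k.1 : ℝ) + 1) with hc
  have hc0 : 0 ≤ c := Finset.prod_nonneg fun k _ => by positivity
  have hterm : ∀ f : {f : Fin J → ℤ × ℤ × ℤ // validChain N n f},
      ENNReal.ofReal ((∏ k : Fin J, 1 / |((mutGen n f.1 k : ℤ) : ℝ)|) ^ 2) ≤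
        ENNReal.ofReal c * Φ f.1 := by
    rintro ⟨f, hf⟩
    have hΦ : Φ f = ENNReal.ofReal (∏ k, |((mutGen n f k : ℤ) : ℝ)| ^ (-(1 + s))) := by
      rw [ENNReal.ofReal_prod_of_nonneg fun k _ => by positivity]
      refine Finset.prod_congr rfl fun k _ => ?_
      simp only [W]
      have hM : mutGen n f k - muGen n f k +
          2 * (ngen n f k - (f k).1) * (ngen n f k - (f k).2.2) = mutGen n f k :=
        sub_add_cancel _ _
      rw [if_pos (hf.stepValid hN k), hM]
    rw [hΦ, ← ENNReal.ofReal_mul hc0, hc, ← Finset.prod_mul_distrib, ← Finset.prod_pow]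
    refine ENNReal.ofReal_le_ofReal (Finset.prod_le_prod (fun k _ => by positivity) fun k _ => ?_)
    exact one_div_sq_le_of_lower_bound hN hs' (hf.le_abs_mutGen hN k)
  calc _ ≤ ∑' f : {f : Fin J → ℤ × ℤ × ℤ // validChain N n f}, ENNReal.ofReal c * Φ f.1 :=
        ENNReal.tsum_le_tsum hterm
    _ ≤ ∑' f, ENNReal.ofReal c * Φ f :=
        ENNReal.tsum_comp_le_tsum_of_injective Subtype.val_injective fun f =>
          ENNReal.ofReal c * Φ f
    _ ≤ ENNReal.ofReal c * ENNReal.ofReal K ^ J := by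
        rw [ENNReal.tsum_mul_left]
        exact mul_le_mul_right (tsum_prod_chain_le W hstep n J) _
    _ ≤ _ := by
        rw [← ENNReal.ofReal_pow hK, ← ENNReal.ofReal_mul hc0]
        refine ENNReal.ofReal_le_ofReal ?_
        rw [hc, prod_phaseExponent_eq hN0 s hJ, div_mul_eq_mul_div, mul_div_assoc]
        gcongr
        exact Real.pow_div_factorial_le_exp K hK J

theorem l2norm_sq (v : ℤ → ℂ) : l2norm v ^ 2 = ∑' n : ℤ, ‖v n‖ ^ 2 :=
  Real.sq_sqrt (tsum_nonneg fun _ => by positivity)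

theorem norm_Rres_le {v : ℤ → ℂ} (hv : Memℓ2 v) (m : ℤ) :
    ‖Rres v m‖ ≤ 3 * l2norm v ^ 2 * ‖v m‖ := by
  have h1 : ‖v m‖ ^ 2 ≤ l2norm v ^ 2 := by
    rw [l2norm_sq]
    exact hv.le_tsum m fun _ _ => by positivity
  unfold Rres
  rw [← l2norm_sq]
  refine (norm_sub_le _ _).trans ?_
  have h2 : ‖((l2norm v ^ 2 : ℝ) : ℂ)‖ = l2norm v ^ 2 := by
    rw [Complex.norm_real, Real.norm_of_nonneg (by positivity)]
  rw [norm_mul, norm_mul, norm_mul, norm_pow, h2, Complex.norm_real, norm_norm, Complex.norm_ofNat]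
  have := mul_le_mul_of_nonneg_right h1 (norm_nonneg (v m))
  linarith

theorem term14_le {v : ℤ → ℂ} (hv : Memℓ2 v) (n : ℤ) {J : ℕ} (lstar : Leaf J)
    (f : Fin J → ℤ × ℤ × ℤ) :
    term14 v n lstar f ≤ (3 * l2norm v ^ 2 * ∏ k : Fin J, 1 / |((mutGen n f k : ℤ) : ℝ)|) *
      ∏ l : Leaf J, ‖v (leafVal n f l)‖ := by
  unfold term14
  rw [← Finset.mul_prod_erase Finset.univ _ (Finset.mem_univ lstar)]
  have hA : 0 ≤ ∏ k : Fin J, 1 / |((mutGen n f k : ℤ) : ℝ)| :=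
    Finset.prod_nonneg fun k _ => by positivity
  have hB : 0 ≤ ∏ l ∈ Finset.univ.erase lstar, ‖v (leafVal n f l)‖ :=
    Finset.prod_nonneg fun l _ => norm_nonneg _
  calc _ ≤ (∏ k : Fin J, 1 / |((mutGen n f k : ℤ) : ℝ)|) *
        (3 * l2norm v ^ 2 * ‖v (leafVal n f lstar)‖) *
        ∏ l ∈ Finset.univ.erase lstar, ‖v (leafVal n f l)‖ := by
        gcongr
        exact norm_Rres_le hv _
    _ = _ := by ring

theorem term14_nonneg (v : ℤ → ℂ) (n : ℤ) {J : ℕ} (lstar : Leaf J) (f : Fin J → ℤ × ℤ × ℤ) :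
    0 ≤ term14 v n lstar f :=
  mul_nonneg (mul_nonneg (Finset.prod_nonneg fun k _ => by positivity) (norm_nonneg _))
    (Finset.prod_nonneg fun _ _ => norm_nonneg _)

theorem card_Leaf (J : ℕ) : Fintype.card (Leaf J) = 2 * J + 1 := by
  have : Fintype.card (Leaf J) = Fintype.card (Unit ⊕ Fin J × Bool) := rfl
  rw [this]
  simp; ring

theorem tsum_prod_leaves_le {v : ℤ → ℂ} (hv : Memℓ2 v) (N : ℝ) {J : ℕ} (hJ : 0 < J) :
    ∑' n : ℤ, ∑' f : {f : Fin J → ℤ × ℤ × ℤ // validChain N n f},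
      ENNReal.ofReal (∏ l : Leaf J, ‖v (leafVal n f.1 l)‖) ^ 2 ≤
    ENNReal.ofReal ((l2norm v ^ 2) ^ (2 * J + 1)) := by
  let h : ℤ → ENNReal := fun m => ENNReal.ofReal (‖v m‖ ^ 2)
  have hterm : ∀ (n : ℤ) (f : {f : Fin J → ℤ × ℤ × ℤ // validChain N n f}),
      ENNReal.ofReal (∏ l : Leaf J, ‖v (leafVal n f.1 l)‖) ^ 2 =
        ∏ l : Leaf J, h (leafVal n f.1 l) := fun n f => by
    rw [← ENNReal.ofReal_pow (Finset.prod_nonneg fun _ _ => norm_nonneg _), ← Finset.prod_pow,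
      ENNReal.ofReal_prod_of_nonneg fun _ _ => by positivity]
  simp only [hterm]
  rw [← ENNReal.tsum_sigma]
  refine (ENNReal.tsum_comp_le_tsum_of_injective (leafVal_injective hJ)
    fun g : Leaf J → ℤ => ∏ l, h (g l)).trans ?_
  refine (ENNReal.tsum_prod_apply_le h).trans_eq ?_
  rw [card_Leaf, l2norm_sq, ENNReal.ofReal_pow (tsum_nonneg fun _ => by positivity),
    ENNReal.ofReal_tsum_of_nonneg (fun _ => by positivity) hv]

/-- **Bound on the resonant-derivative term `N^{(J+1)}_r`** (per-tree estimate, first-child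
chain, any distinguished leaf). For every `ε > 0` there is `C > 0`, independent of `J` and
`N`, such that for every `J ≥ 2`, `N ≥ 1`, `v ∈ ℓ²(ℤ;ℂ)`, and every distinguished leaf
`ℓ*`: `Q(n)` is finite for each `n`, belongs to `ℓ²(ℤ)`, and
`‖Q‖ ≤ C N^{−J/2 + (J−1)/200 + Jε} ‖v‖^{2J+3}`. -/
theorem NJ1_r_bound : ∀ ε > (0:ℝ), ∃ C > (0:ℝ), ∀ J : ℕ, 2 ≤ J → ∀ N : ℝ, 1 ≤ N →
    ∀ v : ℤ → ℂ, Memℓ2 v → ∀ lstar : Leaf J,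
    (∀ n : ℤ, Summable fun f : {f : Fin J → ℤ × ℤ × ℤ // validChain N n f} =>
      term14 v n lstar f.1) ∧
    Summable (fun n : ℤ => Q14 N v J lstar n ^ 2) ∧
    Real.sqrt (∑' n : ℤ, Q14 N v J lstar n ^ 2)
      ≤ C * N ^ (-(J:ℝ)/2 + ((J:ℝ) - 1)/200 + (J:ℝ) * ε) * l2norm v ^ (2 * J + 3) := by
  intro ε hε
  obtain ⟨K, hK, hsum⟩ := exists_tsum_validChain_le (s := min ε (1 / 2))
    (lt_min hε (by norm_num)) (min_le_right _ _)
  refine ⟨3 * Real.exp K, by positivity, fun J hJ N hN v hv lstar => ?_⟩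
  have hJ0 : 0 < J := by omega
  have hN0 : 0 < N := by linarith
  have hV : 0 ≤ l2norm v := Real.sqrt_nonneg _
  set s := min ε (1 / 2) with hs
  set E : ℝ := -((1 - s) * (1 + (1 - 1 / 100) * ((J : ℝ) - 1))) with hE
  set e : ℝ := -(J:ℝ)/2 + ((J:ℝ) - 1)/200 + (J:ℝ) * ε with he
  set V : ℝ := l2norm v with hVdef
  set M : ℝ := (3 * V ^ 2) ^ 2 * (N ^ E * Real.exp K) with hM
  have hM0 : 0 ≤ M := by positivity
  let B : ℤ → ENNReal := fun n =>
    ∑' f : {f : Fin J → ℤ × ℤ × ℤ // validChain N n f},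
      ENNReal.ofReal (∏ l : Leaf J, ‖v (leafVal n f.1 l)‖) ^ 2
  have hB : ∑' n, B n ≤ ENNReal.ofReal ((V ^ 2) ^ (2 * J + 1)) := tsum_prod_leaves_le hv N hJ0
  have hQ : ∀ n, (∑' f : {f : Fin J → ℤ × ℤ × ℤ // validChain N n f},
      ENNReal.ofReal (term14 v n lstar f.1)) ^ 2 ≤ ENNReal.ofReal M * B n := fun n => by
    calc _ ≤ (∑' f : {f : Fin J → ℤ × ℤ × ℤ // validChain N n f},
          ENNReal.ofReal (3 * V ^ 2 * ∏ k : Fin J, 1 / |((mutGen n f.1 k : ℤ) : ℝ)|) *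
            ENNReal.ofReal (∏ l : Leaf J, ‖v (leafVal n f.1 l)‖)) ^ 2 := by
          refine pow_le_pow_left' (ENNReal.tsum_le_tsum fun f => ?_) 2
          rw [← ENNReal.ofReal_mul (mul_nonneg (by positivity)
            (Finset.prod_nonneg fun k _ => by positivity))]
          exact ENNReal.ofReal_le_ofReal (term14_le hv n lstar f.1)
      _ ≤ _ := ENNReal.tsum_mul_sq_le _ _
      _ ≤ _ := by
          refine mul_le_mul_left ?_ _
          have : ∀ f : {f : Fin J → ℤ × ℤ × ℤ // validChain N n f},
              ENNReal.ofReal (3 * V ^ 2 * ∏ k : Fin J, 1 / |((mutGen n f.1 k : ℤ) : ℝ)|) ^ 2 =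
              ENNReal.ofReal ((3 * V ^ 2) ^ 2) *
                ENNReal.ofReal ((∏ k : Fin J, 1 / |((mutGen n f.1 k : ℤ) : ℝ)|) ^ 2) :=
            fun f => by
              rw [← ENNReal.ofReal_pow (mul_nonneg (by positivity)
                (Finset.prod_nonneg fun k _ => by positivity)), mul_pow,
                ENNReal.ofReal_mul (by positivity)]
          simp only [this]
          rw [ENNReal.tsum_mul_left, hM, ENNReal.ofReal_mul (by positivity)]
          exact mul_le_mul_right (hsum J N n hJ0 hN) _
  have hBn : ∀ n, B n ≠ ⊤ := fun n =>
    ((ENNReal.le_tsum n).trans hB).trans_lt ENNReal.ofReal_lt_top |>.ne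
  have hfin : ∀ n, ∑' f : {f : Fin J → ℤ × ℤ × ℤ // validChain N n f},
      ENNReal.ofReal (term14 v n lstar f.1) ≠ ⊤ := fun n h => by
    have := hQ n
    rw [h, ENNReal.top_pow two_ne_zero, top_le_iff] at this
    exact ENNReal.mul_ne_top ENNReal.ofReal_ne_top (hBn n) this
  have hS : ∀ n : ℤ, Summable fun f : {f : Fin J → ℤ × ℤ × ℤ // validChain N n f} =>
      term14 v n lstar f.1 := fun n => by
    have := ENNReal.summable_toReal (hfin n)
    simpa only [ENNReal.toReal_ofReal (term14_nonneg v n lstar _)] using this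
  have hQ' : ∀ n, ENNReal.ofReal (Q14 N v J lstar n ^ 2) ≤ ENNReal.ofReal M * B n := fun n => by
    unfold Q14
    rw [ENNReal.ofReal_pow (tsum_nonneg fun f => term14_nonneg v n lstar _),
      ENNReal.ofReal_tsum_of_nonneg (fun f => term14_nonneg v n lstar _) (hS n)]
    exact hQ n
  obtain ⟨h1, h2⟩ := summable_and_tsum_le_of_tsum_ofReal_le
    (g := fun n => Q14 N v J lstar n ^ 2) (c := M * (V ^ 2) ^ (2 * J + 1))
    (fun n => sq_nonneg _) (by positivity) (by
      rw [ENNReal.ofReal_mul hM0]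
      refine (ENNReal.tsum_le_tsum hQ').trans ?_
      rw [ENNReal.tsum_mul_left]
      exact mul_le_mul_right hB _)
  refine ⟨hS, h1, Real.sqrt_le_iff.2 ⟨by positivity, h2.trans ?_⟩⟩
  have hEe : E ≤ e * 2 := by
    have hsε : s ≤ ε := min_le_left _ _
    have hJ1 : (2 : ℝ) ≤ J := by exact_mod_cast hJ
    rw [hE, he]
    nlinarith
  have hNE : N ^ E ≤ (N ^ e) ^ 2 := by
    rw [← Real.rpow_two, ← Real.rpow_mul hN0.le]
    exact Real.rpow_le_rpow_of_exponent_le hN hEe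
  have hexp : Real.exp K ≤ Real.exp K ^ 2 :=
    le_self_pow₀ (Real.one_le_exp hK) two_ne_zero
  calc M * (V ^ 2) ^ (2 * J + 1)
      ≤ ((3 * V ^ 2) ^ 2 * ((N ^ e) ^ 2 * Real.exp K ^ 2)) * (V ^ 2) ^ (2 * J + 1) := by
        rw [hM]; gcongr
    _ = (3 * Real.exp K * N ^ e * V ^ (2 * J + 3)) ^ 2 := by ring
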